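/- Let N ≥ 2 be an integer, α > 0, and β, μ ∈ ℝ. Then there exist constants C > 0 and t₀ > 0 such that for all t ≥ t₀: (1/C)·(αt)^β·(ln(αt))^μ·e^{αt} ≤ Σ_{k=N}^∞ ((αt)^k / k!)·k^β·(ln k)^μ ≤ C·(αt)^β·(ln(αt))^μ·e^{αt}. -/

import Mathlib

open Filter Topology

theorem Real.rpow_le_rpow_abs_of_inv_le {a b : ℝ} (p : ℝ) (ha : 0 < a) (hab : a ≤ b)
    (hinv : a⁻¹ ≤ b) : a ^ p ≤ b ^ |p| := by
  rcases le_total 0 p with hp | hp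
  · rw [abs_of_nonneg hp]
    exact Real.rpow_le_rpow ha.le hab hp
  · rw [abs_of_nonpos hp]
    calc a ^ p = a⁻¹ ^ (-p) := by
          rw [Real.inv_rpow ha.le, Real.rpow_neg ha.le, inv_inv]
      _ ≤ b ^ (-p) := Real.rpow_le_rpow (inv_pos.2 ha).le hinv (by linarith)

/-- `log y / log x` is controlled by `y / x + x / y`. -/
theorem Real.log_le_log_mul_one_add_div {x y : ℝ} (hx : 0 < x) (hy : 0 < y)
    (hlog : 1 / 2 ≤ Real.log x) : Real.log y ≤ Real.log x * (1 + 2 * (y / x)) := by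
  have h := Real.log_le_sub_one_of_pos (div_pos hy hx)
  rw [Real.log_div hy.ne' hx.ne'] at h
  have h2 : 0 < y / x := div_pos hy hx
  nlinarith

theorem rpow_mul_log_rpow_le (β μ : ℝ) :
    ∃ M : ℕ, ∃ K > 0, ∀ x y : ℝ, 2 ≤ x → 2 ≤ y →
      y ^ β * Real.log y ^ μ ≤
        K * (x ^ β * Real.log x ^ μ) * ((y / x) ^ M + (x / y) ^ M) := by
  obtain ⟨M, hM⟩ := exists_nat_ge (|β| + |μ|)
  refine ⟨M, 3 ^ |μ| * 2 ^ (M - 1), by positivity, fun x y hx hy => ?_⟩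
  have hx0 : 0 < x := by linarith
  have hy0 : 0 < y := by linarith
  have half_le_log : ∀ z : ℝ, 2 ≤ z → 1 / 2 ≤ Real.log z := fun z hz => by
    have := Real.log_two_gt_d9
    have := Real.log_le_log (by norm_num) hz
    linarith
  have hlx := half_le_log x hx
  have hly := half_le_log y hy
  have hlx0 : 0 < Real.log x := by linarith
  have hly0 : 0 < Real.log y := by linarith
  have hu : 0 < y / x := by positivity
  have hv : 0 < x / y := by positivity
  set b := y / x + x / y with hb
  have hb1 : 1 ≤ b := by
    have huv : (y / x) * (x / y) = 1 := by field_simp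
    nlinarith [sq_nonneg (y / x - x / y)]
  have hb0 : 0 < b := by linarith
  have hpow : (y / x) ^ β ≤ b ^ |β| :=
    Real.rpow_le_rpow_abs_of_inv_le β hu (by linarith) (by rw [inv_div]; linarith)
  have hlog : (Real.log y / Real.log x) ^ μ ≤ (3 * b) ^ |μ| := by
    apply Real.rpow_le_rpow_abs_of_inv_le μ (by positivity)
    · rw [div_le_iff₀' hlx0]
      refine (Real.log_le_log_mul_one_add_div hx0 hy0 hlx).trans ?_
      gcongr
      linarith
    · rw [inv_div, div_le_iff₀' hly0]
      refine (Real.log_le_log_mul_one_add_div hy0 hx0 hly).trans ?_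
      gcongr
      linarith
  have hsplit : y ^ β * Real.log y ^ μ =
      (x ^ β * Real.log x ^ μ) * ((y / x) ^ β * (Real.log y / Real.log x) ^ μ) := by
    rw [Real.div_rpow hy0.le hx0.le, Real.div_rpow hly0.le hlx0.le]
    have := (Real.rpow_pos_of_pos hx0 β).ne'
    have := (Real.rpow_pos_of_pos hlx0 μ).ne'
    field_simp
  have hratio : (y / x) ^ β * (Real.log y / Real.log x) ^ μ ≤
      3 ^ |μ| * (2 ^ (M - 1) * ((y / x) ^ M + (x / y) ^ M)) :=
    calc (y / x) ^ β * (Real.log y / Real.log x) ^ μ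
        ≤ b ^ |β| * (3 * b) ^ |μ| := by gcongr
      _ = 3 ^ |μ| * b ^ (|β| + |μ|) := by
          rw [Real.mul_rpow (by norm_num) hb0.le, Real.rpow_add hb0]; ring
      _ ≤ 3 ^ |μ| * b ^ (M : ℝ) := by gcongr
      _ ≤ 3 ^ |μ| * (2 ^ (M - 1) * ((y / x) ^ M + (x / y) ^ M)) := by
          rw [Real.rpow_natCast]
          gcongr
          exact add_pow_le hu.le hv.le M
  rw [hsplit]
  calc _ ≤ (x ^ β * Real.log x ^ μ) *
        (3 ^ |μ| * (2 ^ (M - 1) * ((y / x) ^ M + (x / y) ^ M))) := by gcongr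
    _ = _ := by ring

theorem Real.hasSum_pow_div_factorial (x : ℝ) :
    HasSum (fun k : ℕ => x ^ k / (k.factorial : ℝ)) (Real.exp x) := by
  rw [Real.exp_eq_exp_ℝ]
  exact NormedSpace.expSeries_div_hasSum_exp x

theorem Real.mul_exp_inv_le {x : ℝ} (hx : 1 ≤ x) : x * Real.exp (1 / x) ≤ x + 2 := by
  have hx0 : 0 < x := by linarith
  have h1 : 1 / x ≤ 1 := by rw [div_le_one hx0]; exact hx
  have h := (abs_le.1 (Real.abs_exp_sub_one_sub_id_le (x := 1 / x)
    (by rw [abs_of_pos (by positivity)]; exact h1))).2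
  calc x * Real.exp (1 / x) ≤ x * (1 + 1 / x + (1 / x) ^ 2) := by gcongr; linarith
    _ = x + 1 + 1 / x := by field_simp
    _ ≤ x + 2 := by linarith

theorem pow_div_factorial_mul_div_pow_le {x : ℝ} (hx : 0 ≤ x) (M : ℕ) {n : ℕ} (hn : 1 ≤ n) :
    x ^ n / (n.factorial : ℝ) * (x / n) ^ M ≤
      (M + 1 : ℝ) ^ M * (x ^ (n + M) / ((n + M).factorial : ℝ)) := by
  have hn0 : (0 : ℝ) < n := by exact_mod_cast hn
  have hfac : ((n + M).factorial : ℝ) ≤ n.factorial * ((M + 1) * n : ℝ) ^ M := by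
    have h1 : (n + M).factorial ≤ n.factorial * ((M + 1) * n) ^ M := by
      rw [← Nat.factorial_mul_ascFactorial]
      refine Nat.mul_le_mul_left _ ((Nat.ascFactorial_le_pow_add n M).trans ?_)
      exact Nat.pow_le_pow_left (by nlinarith) M
    exact_mod_cast h1
  have hpos : (0 : ℝ) < (n + M).factorial := by positivity
  rw [div_pow, div_mul_div_comm, ← pow_add, mul_div_assoc', div_le_div_iff₀ (by positivity) hpos]
  calc x ^ (n + M) * ((n + M).factorial : ℝ)
      ≤ x ^ (n + M) * (n.factorial * ((M + 1) * n : ℝ) ^ M) := by gcongr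
    _ = _ := by rw [mul_pow]; ring

/-- The upper bound, with summability. -/
theorem summable_and_tsum_pow_div_factorial_mul_le (β μ : ℝ) :
    ∃ C > 0, ∀ N : ℕ, 2 ≤ N → ∀ x : ℝ, 2 ≤ x →
      Summable (fun k : ℕ => (x ^ (k + N) / (Nat.factorial (k + N) : ℝ)) *
        (((k + N : ℕ) : ℝ) ^ β * Real.log ((k + N : ℕ) : ℝ) ^ μ)) ∧
      ∑' k : ℕ, (x ^ (k + N) / (Nat.factorial (k + N) : ℝ)) *
        (((k + N : ℕ) : ℝ) ^ β * Real.log ((k + N : ℕ) : ℝ) ^ μ) ≤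
          C * (x ^ β * Real.log x ^ μ) * Real.exp x := by
  obtain ⟨M, K, hK, hbound⟩ := rpow_mul_log_rpow_le β μ
  refine ⟨K * (M.factorial * Real.exp 2 + (M + 1) ^ M), by positivity, fun N hN x hx => ?_⟩
  have hx0 : 0 < x := by linarith
  have hlx0 : 0 < Real.log x := Real.log_pos (by linarith)
  set F := x ^ β * Real.log x ^ μ with hF
  have hF0 : 0 < F := by positivity
  let g : ℕ → ℝ := fun n => M.factorial * ((x * Real.exp (1 / x)) ^ n / (n.factorial : ℝ))
  let h : ℕ → ℝ := fun n => (M + 1 : ℝ) ^ M * (x ^ n / (n.factorial : ℝ))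
  have hg : HasSum g (M.factorial * Real.exp (x * Real.exp (1 / x))) :=
    (Real.hasSum_pow_div_factorial _).mul_left _
  have hh : HasSum h ((M + 1 : ℝ) ^ M * Real.exp x) :=
    (Real.hasSum_pow_div_factorial _).mul_left _
  have hgN : Summable fun k => g (k + N) := (summable_nat_add_iff N).2 hg.summable
  have hhN : Summable fun k => h (k + (N + M)) := (summable_nat_add_iff (N + M)).2 hh.summable
  have hgle : ∑' k, g (k + N) ≤ M.factorial * Real.exp (x * Real.exp (1 / x)) := by
    rw [← hg.tsum_eq]
    exact tsum_comp_le_tsum_of_inj hg.summable (fun n => by positivity) (add_left_injective N)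
  have hhle : ∑' k, h (k + (N + M)) ≤ (M + 1 : ℝ) ^ M * Real.exp x := by
    rw [← hh.tsum_eq]
    exact tsum_comp_le_tsum_of_inj hh.summable (fun n => by positivity)
      (add_left_injective (N + M))
  have hterm : ∀ k : ℕ, (x ^ (k + N) / (Nat.factorial (k + N) : ℝ)) *
      (((k + N : ℕ) : ℝ) ^ β * Real.log ((k + N : ℕ) : ℝ) ^ μ) ≤
        K * F * (g (k + N) + h (k + (N + M))) := by
    intro k
    rw [← add_assoc]
    have hn : 2 ≤ k + N := by omega
    generalize k + N = n at hn
    have hexp : x ^ n / (n.factorial : ℝ) * ((n : ℝ) / x) ^ M ≤ g n := by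
      have h1 := Real.pow_div_factorial_le_exp ((n : ℝ) / x) (by positivity) M
      rw [div_le_iff₀ (by positivity)] at h1
      calc x ^ n / (n.factorial : ℝ) * ((n : ℝ) / x) ^ M
          ≤ x ^ n / (n.factorial : ℝ) * (Real.exp (n / x) * M.factorial) := by gcongr
        _ = g n := by
          simp only [g]
          rw [mul_pow, ← Real.exp_nat_mul, mul_one_div]; ring
    have hinv := pow_div_factorial_mul_div_pow_le hx0.le M (show 1 ≤ n by omega)
    calc _ ≤ (x ^ n / (n.factorial : ℝ)) * (K * F * (((n : ℝ) / x) ^ M + (x / n) ^ M)) := by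
          refine mul_le_mul_of_nonneg_left ?_ (by positivity)
          exact hbound x n hx (by exact_mod_cast hn)
      _ = K * F * (x ^ n / (n.factorial : ℝ) * ((n : ℝ) / x) ^ M +
            x ^ n / (n.factorial : ℝ) * (x / n) ^ M) := by ring
      _ ≤ K * F * (g n + h (n + M)) := by gcongr
  have hsum := (hgN.add hhN).mul_left (K * F)
  have hS := Summable.of_nonneg_of_le (fun k => ?_) hterm hsum
  · refine ⟨hS, (hS.tsum_le_tsum hterm hsum).trans ?_⟩
    rw [tsum_mul_left, hgN.tsum_add hhN]
    have he : Real.exp (x * Real.exp (1 / x)) ≤ Real.exp 2 * Real.exp x := by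
      rw [← Real.exp_add, Real.exp_le_exp, add_comm 2 x]
      exact Real.mul_exp_inv_le (by linarith)
    calc _ ≤ K * F * (M.factorial * (Real.exp 2 * Real.exp x) + (M + 1 : ℝ) ^ M * Real.exp x) := by
          gcongr
          exact hgle.trans (by gcongr)
      _ = _ := by ring
  · have : 0 ≤ Real.log ((k + N : ℕ) : ℝ) := Real.log_natCast_nonneg _
    positivity

theorem eventually_half_exp_le_tsum_pow_div_factorial (N : ℕ) :
    ∀ᶠ x : ℝ in atTop,
      Real.exp x / 2 ≤ ∑' k : ℕ, x ^ (k + N) / (Nat.factorial (k + N) : ℝ) := by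
  have hlim : Tendsto (fun x : ℝ => ∑ k ∈ Finset.range N,
      (x ^ k * Real.exp (-x)) / (k.factorial : ℝ)) atTop (𝓝 0) := by
    have := tendsto_finsetSum (Finset.range N) fun k _ =>
      (Real.tendsto_pow_mul_exp_neg_atTop_nhds_zero k).div_const (k.factorial : ℝ)
    simpa using this
  filter_upwards [hlim.eventually_le_const (show (0 : ℝ) < 1 / 2 by norm_num)] with x hx
  have hsum := (Real.hasSum_pow_div_factorial x).summable.sum_add_tsum_nat_add N
  rw [(Real.hasSum_pow_div_factorial x).tsum_eq] at hsum
  have hfin : ∑ k ∈ Finset.range N, x ^ k / (k.factorial : ℝ) ≤ 1 / 2 * Real.exp x := by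
    calc ∑ k ∈ Finset.range N, x ^ k / (k.factorial : ℝ)
        = (∑ k ∈ Finset.range N, (x ^ k * Real.exp (-x)) / (k.factorial : ℝ)) * Real.exp x := by
          rw [Finset.sum_mul]
          refine Finset.sum_congr rfl fun k _ => ?_
          rw [Real.exp_neg]
          field_simp
      _ ≤ 1 / 2 * Real.exp x := by gcongr
  linarith


/-- For integers `N ≥ 2`, `α > 0`, `β, μ ∈ ℝ`, there are constants `C > 0`, `t₀ > 0` with
`(1/C)(αt)^β (ln(αt))^μ e^{αt} ≤ Σ_{k=N}^∞ ((αt)^k/k!) k^β (ln k)^μ ≤ C (αt)^β (ln(αt))^μ e^{αt}`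
for all `t ≥ t₀`. -/
theorem stmt6 (N : ℕ) (hN : 2 ≤ N) (α β μ : ℝ) (hα : 0 < α) :
    ∃ C > 0, ∃ t₀ > 0, ∀ t, t₀ ≤ t →
      (1 / C) * (α * t) ^ β * Real.log (α * t) ^ μ * Real.exp (α * t) ≤
          ∑' k : ℕ, ((α * t) ^ (k + N) / (Nat.factorial (k + N) : ℝ)) *
            (((k + N : ℕ) : ℝ) ^ β * Real.log ((k + N : ℕ) : ℝ) ^ μ) ∧
        ∑' k : ℕ, ((α * t) ^ (k + N) / (Nat.factorial (k + N) : ℝ)) *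
            (((k + N : ℕ) : ℝ) ^ β * Real.log ((k + N : ℕ) : ℝ) ^ μ) ≤
          C * (α * t) ^ β * Real.log (α * t) ^ μ * Real.exp (α * t) := by
  obtain ⟨C₁, hC₁, hupper⟩ := summable_and_tsum_pow_div_factorial_mul_le β μ
  obtain ⟨C₂, hC₂, hdual⟩ := summable_and_tsum_pow_div_factorial_mul_le (-β) (-μ)
  obtain ⟨x₀, hx₀⟩ := eventually_atTop.1 (eventually_half_exp_le_tsum_pow_div_factorial N)
  refine ⟨C₁ + 4 * C₂, by positivity, max x₀ 2 / α, by positivity, fun t ht => ?_⟩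
  rw [div_le_iff₀' hα] at ht
  generalize α * t = x at ht
  have hx : 2 ≤ x := (le_max_right _ _).trans ht
  have htail := hx₀ x ((le_max_left _ _).trans ht)
  have hx0 : 0 < x := by linarith
  have hlx0 : 0 < Real.log x := Real.log_pos (by linarith)
  obtain ⟨hS, hSle⟩ := hupper N hN x hx
  obtain ⟨hS', hSle'⟩ := hdual N hN x hx
  have hT : Summable fun k : ℕ => x ^ (k + N) / (Nat.factorial (k + N) : ℝ) :=
    (summable_nat_add_iff N).2 (Real.hasSum_pow_div_factorial x).summable
  have hFG : x ^ (-β) * Real.log x ^ (-μ) = (x ^ β * Real.log x ^ μ)⁻¹ := by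
    rw [Real.rpow_neg hx0.le, Real.rpow_neg hlx0.le, mul_inv]
  rw [hFG] at hSle'
  have hF0 : 0 < x ^ β * Real.log x ^ μ := by positivity
  rw [mul_assoc (1 / (C₁ + 4 * C₂)), mul_assoc (C₁ + 4 * C₂)]
  set F := x ^ β * Real.log x ^ μ with hF
  set c := F / (2 * C₂) with hc
  -- AM-GM: `2 * c ≤ f + c ^ 2 / f` for each coefficient `f = k ^ β * (log k) ^ μ`
  have hterm : ∀ k : ℕ, 2 * c * (x ^ (k + N) / (Nat.factorial (k + N) : ℝ)) ≤
      (x ^ (k + N) / (Nat.factorial (k + N) : ℝ)) *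
        (((k + N : ℕ) : ℝ) ^ β * Real.log ((k + N : ℕ) : ℝ) ^ μ) +
      c ^ 2 * ((x ^ (k + N) / (Nat.factorial (k + N) : ℝ)) *
        (((k + N : ℕ) : ℝ) ^ (-β) * Real.log ((k + N : ℕ) : ℝ) ^ (-μ))) := by
    intro k
    have hn : 2 ≤ k + N := by omega
    generalize k + N = n at hn
    have hn2 : (2 : ℝ) ≤ n := by exact_mod_cast hn
    have hn0 : (0 : ℝ) < n := by linarith
    have hln0 : 0 < Real.log n := Real.log_pos (by linarith)
    rw [Real.rpow_neg hn0.le, Real.rpow_neg hln0.le, ← mul_inv]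
    have hf0 : 0 < (n : ℝ) ^ β * Real.log n ^ μ := by positivity
    generalize (n : ℝ) ^ β * Real.log n ^ μ = f at hf0
    have hamgm : 2 * c ≤ f + c ^ 2 * f⁻¹ := by
      have h1 : f + c ^ 2 * f⁻¹ - 2 * c = (f - c) ^ 2 * f⁻¹ := by field_simp; ring
      have h2 : 0 ≤ (f - c) ^ 2 * f⁻¹ := by positivity
      linarith
    calc _ ≤ (f + c ^ 2 * f⁻¹) * (x ^ n / (n.factorial : ℝ)) := by gcongr
      _ = _ := by ring
  have hsum := (hT.mul_left (2 * c)).tsum_le_tsum hterm (hS.add (hS'.mul_left (c ^ 2)))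
  rw [hS.tsum_add (hS'.mul_left (c ^ 2)), tsum_mul_left, tsum_mul_left] at hsum
  constructor
  · have hc0 : 0 < c := by positivity
    have h1 := mul_le_mul_of_nonneg_left htail (show 0 ≤ 2 * c by positivity)
    have h2 := mul_le_mul_of_nonneg_left hSle' (sq_nonneg c)
    have h3 : 2 * c * (Real.exp x / 2) - c ^ 2 * (C₂ * F⁻¹ * Real.exp x) =
        1 / (4 * C₂) * F * Real.exp x := by
      rw [hc]; field_simp; ring
    have h4 : 1 / (C₁ + 4 * C₂) * F * Real.exp x ≤ 1 / (4 * C₂) * F * Real.exp x := by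
      gcongr
      linarith
    linarith
  · refine hSle.trans ?_
    gcongr
    linarith
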